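/- Let Γ = (Σ₁, Σ₂; P₁, P₂) be a two-person game with payoffs bounded below in the co-player's variable. If (σ₁*, σ₂*) is a strict Nash equilibrium of Γ, then (σ₁*, σ₂*) is a strict Nash equilibrium of the flat game Γ♭ = (Σ₁, Σ₂; P♭₁, P♭₂). -/

import Mathlib

/-- Lower payoff of player 1:
`P♭₁(σ₁,σ₂) = inf { P₁(σ₁,τ) : τ, P₂(σ₁,τ) ≥ P₂(σ₁,σ₂) }`. -/
noncomputable def flat1 {X Y : Type} (P1 P2 : X → Y → ℝ) (σ1 : X) (σ2 : Y) : ℝ :=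
  sInf {v : ℝ | ∃ τ : Y, P2 σ1 σ2 ≤ P2 σ1 τ ∧ P1 σ1 τ = v}

/-- Lower payoff of player 2:
`P♭₂(σ₁,σ₂) = inf { P₂(τ,σ₂) : τ, P₁(τ,σ₂) ≥ P₁(σ₁,σ₂) }`. -/
noncomputable def flat2 {X Y : Type} (P1 P2 : X → Y → ℝ) (σ1 : X) (σ2 : Y) : ℝ :=
  sInf {v : ℝ | ∃ τ : X, P1 σ1 σ2 ≤ P1 τ σ2 ∧ P2 τ σ2 = v}

/-- Nash equilibrium of the two-person game `(X, Y; P1, P2)`. -/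
def IsNE {X Y : Type} (P1 P2 : X → Y → ℝ) (s : X × Y) : Prop :=
  (∀ σ1 : X, P1 σ1 s.2 ≤ P1 s.1 s.2) ∧ (∀ σ2 : Y, P2 s.1 σ2 ≤ P2 s.1 s.2)

/-- Strict Nash equilibrium. -/
def IsSNE {X Y : Type} (P1 P2 : X → Y → ℝ) (s : X × Y) : Prop :=
  (∀ σ1 : X, σ1 ≠ s.1 → P1 σ1 s.2 < P1 s.1 s.2) ∧
  (∀ σ2 : Y, σ2 ≠ s.2 → P2 s.1 σ2 < P2 s.1 s.2)

theorem flat1_le {X Y : Type} (P1 P2 : X → Y → ℝ) {x : X}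
    (hB : BddBelow (Set.range fun y : Y => P1 x y)) (y : Y) :
    flat1 P1 P2 x y ≤ P1 x y :=
  csInf_le (hB.mono (by rintro _ ⟨τ, _, hτ⟩; exact ⟨τ, hτ⟩)) ⟨y, le_rfl, rfl⟩

theorem flat2_le {X Y : Type} (P1 P2 : X → Y → ℝ) {y : Y}
    (hB : BddBelow (Set.range fun x : X => P2 x y)) (x : X) :
    flat2 P1 P2 x y ≤ P2 x y :=
  csInf_le (hB.mono (by rintro _ ⟨τ, _, hτ⟩; exact ⟨τ, hτ⟩)) ⟨x, le_rfl, rfl⟩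

/-- If `y` is the unique best response to `x`, the lower payoff of player 1 at `(x, y)` is the
payoff itself. -/
theorem flat1_eq_of_forall_lt {X Y : Type} (P1 P2 : X → Y → ℝ) {x : X} {y : Y}
    (h : ∀ τ : Y, τ ≠ y → P2 x τ < P2 x y) : flat1 P1 P2 x y = P1 x y := by
  refine IsLeast.csInf_eq ⟨⟨y, le_rfl, rfl⟩, ?_⟩
  rintro _ ⟨τ, hτ, rfl⟩
  obtain rfl : τ = y := of_not_not fun hne => (h τ hne).not_ge hτ
  exact le_rfl

/-- If `x` is the unique best response to `y`, the lower payoff of player 2 at `(x, y)` is the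
payoff itself. -/
theorem flat2_eq_of_forall_lt {X Y : Type} (P1 P2 : X → Y → ℝ) {x : X} {y : Y}
    (h : ∀ τ : X, τ ≠ x → P1 τ y < P1 x y) : flat2 P1 P2 x y = P2 x y := by
  refine IsLeast.csInf_eq ⟨⟨x, le_rfl, rfl⟩, ?_⟩
  rintro _ ⟨τ, hτ, rfl⟩
  obtain rfl : τ = x := of_not_not fun hne => (h τ hne).not_ge hτ
  exact le_rfl

/-- A strict Nash equilibrium of a game is a strict Nash equilibrium of its flat
game. -/
theorem SNE_flat {X Y : Type} [Nonempty X] [Nonempty Y]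
    (P1 P2 : X → Y → ℝ)
    (hB1 : ∀ σ1 : X, BddBelow (Set.range fun σ2 : Y => P1 σ1 σ2))
    (hB2 : ∀ σ2 : Y, BddBelow (Set.range fun σ1 : X => P2 σ1 σ2))
    (s : X × Y) (hs : IsSNE P1 P2 s) :
    IsSNE (flat1 P1 P2) (flat2 P1 P2) s := by
  refine ⟨fun σ1 h => ?_, fun σ2 h => ?_⟩
  · rw [flat1_eq_of_forall_lt P1 P2 hs.2]
    exact (flat1_le P1 P2 (hB1 σ1) s.2).trans_lt (hs.1 σ1 h)
  · rw [flat2_eq_of_forall_lt P1 P2 hs.1]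
    exact (flat2_le P1 P2 (hB2 σ2) s.1).trans_lt (hs.2 σ2 h)
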